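/- arXiv:math/0505467 — 2 statements merged into one kernel-verified Lean document; each statement's English description precedes it below -/
import Mathlib

section
/- Let P_0 = K[x_1,…,x_m] be a polynomial ring over a field K, F a finitely generated graded free P_0-module with homogeneous basis u_1,…,u_r, and U a graded submodule of F. For f = Σ_{i=1}^r f_i u_i ∈ U, f homogeneous and nonzero, set in(f) = f_j u_j where j is the least index with f_j ≠ 0, and let in(U) be the submodule of F generated by all in(f), f ∈ U. Then F/U and F/in(U) have the same Hilbert series: dim_K (F/U)_i = dim_K (F/in(U))_i for all i. -/
/-!
Formalization of the Macaulay-type lemma (Lemma 3.3) of "On the regularity of local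
cohomology of bigraded algebras" (A. Rahimi): for a graded submodule `U` of a graded free
module `F = ⊕ᵢ P₀ uᵢ` over `P₀ = K[x₁,…,x_m]` (basis element `uᵢ` homogeneous of degree
`eᵢ`), the quotients `F/U` and `F/in(U)` have the same Hilbert function, where `in(U)` is
generated by the initial terms `in(g) = gⱼ uⱼ` (`j` minimal with `gⱼ ≠ 0`) of elements of `U`.
-/

open MvPolynomial

namespace Paper

/-- Total degree of an exponent vector. -/
def tdeg {m : ℕ} (ν : Fin m →₀ ℕ) : ℕ := ν.sum fun _ e => e

variable (K : Type) [Field K] (m r : ℕ)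

/-- The degree-`d` strand of the graded free module `F = ⊕ᵢ P₀ uᵢ` with `deg uᵢ = eᵢ`. -/
def strandF (e : Fin r → ℕ) (d : ℕ) :
    Submodule K (Fin r →₀ MvPolynomial (Fin m) K) where
  carrier := {g | ∀ i ν, MvPolynomial.coeff ν (g i) ≠ 0 → tdeg ν + e i = d}
  add_mem' := by
    intro a b ha hb i ν h
    rw [Finsupp.add_apply, MvPolynomial.coeff_add] at h
    by_cases h1 : MvPolynomial.coeff ν (a i) ≠ 0
    · exact ha i ν h1
    · push_neg at h1
      exact hb i ν (by simpa [h1] using h)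
  zero_mem' := by intro i ν h; simp at h
  smul_mem' := by
    intro k g hg i ν h
    rw [Finsupp.smul_apply, MvPolynomial.coeff_smul] at h
    exact hg i ν (right_ne_zero_of_smul h)

/-- The initial submodule `in(U)` of `U ⊆ F = ⊕ᵢ P₀ uᵢ` for the position-over-term order:
it is generated by the initial terms `in(g) = Finsupp.single j (g j)`, where `j` is the
least index with `g j ≠ 0`, for `g ∈ U`, `g ≠ 0`. -/
noncomputable def iniSub (U : Submodule (MvPolynomial (Fin m) K) (Fin r →₀ MvPolynomial (Fin m) K)) :
    Submodule (MvPolynomial (Fin m) K) (Fin r →₀ MvPolynomial (Fin m) K) :=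
  Submodule.span (MvPolynomial (Fin m) K)
    {w | ∃ g ∈ U, ∃ j : Fin r, g j ≠ 0 ∧ (∀ i, i < j → g i = 0) ∧ w = Finsupp.single j (g j)}

theorem tdeg_eq_degree {m : ℕ} (ν : Fin m →₀ ℕ) : tdeg ν = ν.degree := rfl

theorem finrank_map_add_inf {A B : Type*} [AddCommGroup A] [Module K A] [AddCommGroup B]
    [Module K B] (f : A →ₗ[K] B) (V : Submodule K A) [FiniteDimensional K V] :
    Module.finrank K (Submodule.map f V) + Module.finrank K ↥(V ⊓ LinearMap.ker f) =
      Module.finrank K V := by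
  have h := LinearMap.finrank_range_add_finrank_ker (f.domRestrict V)
  rw [LinearMap.range_domRestrict] at h
  rw [← h]
  congr 1
  rw [← Submodule.finrank_map_subtype_eq V (LinearMap.ker (f.domRestrict V))]
  have hE : V ⊓ LinearMap.ker f =
      Submodule.map V.subtype (LinearMap.ker (f.domRestrict V)) := by
    ext x
    simp [LinearMap.mem_ker, and_comm]
  rw [hE]

/-- Elements whose first `k` components vanish. -/
def tailSub (A : Type*) [AddCommGroup A] [Module K A] (k : ℕ) : Submodule K (Fin r →₀ A) where
  carrier := {g | ∀ i : Fin r, i.val < k → g i = 0}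
  add_mem' := by
    intro a b ha hb i hi
    simp [ha i hi, hb i hi]
  zero_mem' := by intro i hi; rfl
  smul_mem' := by
    intro c a ha i hi
    simp [ha i hi]

theorem finrank_eq_of_lead {A : Type*} [AddCommGroup A] [Module K A]
    (W W' : Submodule K (Fin r →₀ A)) [FiniteDimensional K W] [FiniteDimensional K W']
    (h : ∀ (j : Fin r) (a : A), (∃ g ∈ W, (∀ i, i < j → g i = 0) ∧ g j = a) ↔
      (∃ g ∈ W', (∀ i, i < j → g i = 0) ∧ g j = a)) :
    Module.finrank K W = Module.finrank K W' := by
  have key : ∀ n k : ℕ, k + n = r → Module.finrank K ↥(W ⊓ tailSub K r A k) =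
      Module.finrank K ↥(W' ⊓ tailSub K r A k) := by
    intro n
    induction n with
    | zero =>
      intro k hk
      have hb : tailSub K r A k = ⊥ := by
        rw [eq_bot_iff]
        intro g hg
        rw [Submodule.mem_bot]
        ext i
        exact hg i (by omega)
      rw [hb, inf_bot_eq, inf_bot_eq]
    | succ n ih =>
      intro k hk
      have hkr : k < r := by omega
      have ih' := ih (k + 1) (by omega)
      have hs : ∀ X : Submodule K (Fin r →₀ A),
          (X ⊓ tailSub K r A k) ⊓ LinearMap.ker (Finsupp.lapply (R := K) (M := A) (⟨k, hkr⟩ : Fin r))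
            = X ⊓ tailSub K r A (k + 1) := by
        intro X
        ext g
        simp only [Submodule.mem_inf, LinearMap.mem_ker, Finsupp.lapply_apply, and_assoc]
        refine and_congr_right fun _ => ⟨?_, ?_⟩
        · rintro ⟨h1, h2⟩ i hi
          rcases Nat.lt_succ_iff_lt_or_eq.mp hi with h3 | h3
          · exact h1 i h3
          · have : i = ⟨k, hkr⟩ := Fin.ext h3
            rw [this]; exact h2
        · intro h1
          exact ⟨fun i hi => h1 i (by omega), h1 _ (Nat.lt_succ_self k)⟩
      have e1 := finrank_map_add_inf K (Finsupp.lapply (R := K) (M := A) (⟨k, hkr⟩ : Fin r))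
        (W ⊓ tailSub K r A k)
      have e2 := finrank_map_add_inf K (Finsupp.lapply (R := K) (M := A) (⟨k, hkr⟩ : Fin r))
        (W' ⊓ tailSub K r A k)
      rw [hs] at e1 e2
      have hm : Submodule.map (Finsupp.lapply (R := K) (M := A) (⟨k, hkr⟩ : Fin r))
          (W ⊓ tailSub K r A k) = Submodule.map (Finsupp.lapply (R := K) (M := A) (⟨k, hkr⟩ : Fin r))
          (W' ⊓ tailSub K r A k) := by
        ext a
        have := h ⟨k, hkr⟩ a
        simp only [Submodule.mem_map, Submodule.mem_inf, and_assoc, Finsupp.lapply_apply]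
        exact this
      rw [hm] at e1
      omega
  have ht : tailSub K r A 0 = ⊤ := by
    rw [eq_top_iff]
    intro g _ i hi
    omega
  have := key r 0 (by omega)
  rwa [ht, inf_top_eq, inf_top_eq] at this

/-- Homogeneous component of degree `d`. -/
noncomputable def comp (e : Fin r → ℕ) (d : ℕ) (g : Fin r →₀ MvPolynomial (Fin m) K) :
    Fin r →₀ MvPolynomial (Fin m) K :=
  Finsupp.equivFunOnFinite.symm
    (fun i => if e i ≤ d then homogeneousComponent (d - e i) (g i) else 0)

theorem coeff_comp (e : Fin r → ℕ) (d : ℕ) (g : Fin r →₀ MvPolynomial (Fin m) K) (i : Fin r)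
    (ν : Fin m →₀ ℕ) :
    coeff ν (comp K m r e d g i) = if tdeg ν + e i = d then coeff ν (g i) else 0 := by
  rw [tdeg_eq_degree]
  simp only [comp, Finsupp.equivFunOnFinite_symm_apply_apply]
  by_cases h : e i ≤ d
  · rw [if_pos h, coeff_homogeneousComponent]
    have : ν.degree = d - e i ↔ ν.degree + e i = d := by omega
    simp only [this]
  · rw [if_neg h, if_neg (by omega), coeff_zero]

theorem comp_mem (e : Fin r → ℕ) (d : ℕ) (g : Fin r →₀ MvPolynomial (Fin m) K) :
    comp K m r e d g ∈ strandF K m r e d := by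
  intro i ν h
  rw [coeff_comp] at h
  by_contra hc
  exact h (if_neg hc)

theorem comp_add (e : Fin r → ℕ) (d : ℕ) (g h : Fin r →₀ MvPolynomial (Fin m) K) :
    comp K m r e d (g + h) = comp K m r e d g + comp K m r e d h := by
  ext i ν
  simp only [coeff_comp, Finsupp.add_apply, coeff_add]
  split_ifs <;> simp

theorem comp_zero (e : Fin r → ℕ) (d : ℕ) :
    comp K m r e d 0 = 0 := by
  ext i ν
  simp [coeff_comp]

theorem comp_of_mem (e : Fin r → ℕ) (d d' : ℕ) (g : Fin r →₀ MvPolynomial (Fin m) K)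
    (hg : g ∈ strandF K m r e d') :
    comp K m r e d g = if d' = d then g else 0 := by
  ext i ν
  rw [coeff_comp]
  by_cases h0 : coeff ν (g i) = 0
  · split_ifs <;> simp [h0]
  · have := hg i ν h0
    rw [this]
    split_ifs <;> simp

theorem monomial_smul_mem (e : Fin r → ℕ) (d : ℕ) (g : Fin r →₀ MvPolynomial (Fin m) K)
    (hg : g ∈ strandF K m r e d) (μ : Fin m →₀ ℕ) (c : K) :
    (monomial μ c) • g ∈ strandF K m r e (tdeg μ + d) := by
  intro i ν h
  rw [Finsupp.smul_apply, smul_eq_mul, coeff_monomial_mul'] at h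
  split_ifs at h with hle
  · have h2 := hg i _ (right_ne_zero_of_mul h)
    rw [tdeg_eq_degree] at *
    have h3 : ν.degree = (ν - μ).degree + μ.degree := by
      rw [← map_add, tsub_add_cancel_of_le hle]
    rw [tdeg_eq_degree]
    omega
  · exact absurd rfl h

theorem comp_mem_of_graded (e : Fin r → ℕ)
    (U : Submodule (MvPolynomial (Fin m) K) (Fin r →₀ MvPolynomial (Fin m) K))
    (hgraded : U = Submodule.span (MvPolynomial (Fin m) K)
      {g | g ∈ U ∧ ∃ d : ℕ, g ∈ strandF K m r e d})
    (d : ℕ) (g : Fin r →₀ MvPolynomial (Fin m) K) (hg : g ∈ U) : comp K m r e d g ∈ U := by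
  have key : ∀ p : MvPolynomial (Fin m) K, comp K m r e d (p • g) ∈ U := by
    rw [hgraded] at hg
    induction hg using Submodule.span_induction with
    | mem x hx =>
      obtain ⟨hxU, d', hxd⟩ := hx
      intro p
      induction p using MvPolynomial.induction_on' with
      | monomial μ c =>
        rw [comp_of_mem K m r e d _ _ (monomial_smul_mem K m r e d' x hxd μ c)]
        split_ifs
        · exact U.smul_mem _ hxU
        · exact U.zero_mem
      | add p q hp hq =>
        rw [add_smul, comp_add]
        exact U.add_mem hp hq
    | zero => intro p; rw [smul_zero, comp_zero]; exact U.zero_mem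
    | add x y _ _ hx hy =>
      intro p
      rw [smul_add, comp_add]
      exact U.add_mem (hx p) (hy p)
    | smul a x _ hx =>
      intro p
      rw [smul_smul]
      exact hx _
  simpa using key 1

theorem iniSub_lead (U : Submodule (MvPolynomial (Fin m) K) (Fin r →₀ MvPolynomial (Fin m) K))
    (h : Fin r →₀ MvPolynomial (Fin m) K) (hh : h ∈ iniSub K m r U) (j : Fin r) :
    ∃ g ∈ U, (∀ i, i < j → g i = 0) ∧ g j = h j := by
  induction hh using Submodule.span_induction with
  | mem x hx =>
    obtain ⟨g, hg, k, _, hk, rfl⟩ := hx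
    by_cases hjk : k = j
    · subst hjk
      exact ⟨g, hg, hk, by simp⟩
    · exact ⟨0, U.zero_mem, fun _ _ => rfl, by simp [Finsupp.single_apply, hjk]⟩
  | zero => exact ⟨0, U.zero_mem, fun _ _ => rfl, rfl⟩
  | add x y _ _ hx hy =>
    obtain ⟨g, hg, h1, h2⟩ := hx
    obtain ⟨g', hg', h1', h2'⟩ := hy
    exact ⟨g + g', U.add_mem hg hg', fun i hi => by simp [h1 i hi, h1' i hi], by simp [h2, h2']⟩
  | smul a x _ hx =>
    obtain ⟨g, hg, h1, h2⟩ := hx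
    exact ⟨a • g, U.smul_mem _ hg, fun i hi => by simp [h1 i hi], by simp [h2]⟩

theorem strandF_finite (e : Fin r → ℕ) (d : ℕ) : FiniteDimensional K (strandF K m r e d) := by
  have hfin : Finite {ν : Fin m →₀ ℕ // ν.degree ≤ d} := Finsupp.finite_of_degree_le d
  let φ : strandF K m r e d →ₗ[K] (Fin r × {ν : Fin m →₀ ℕ // ν.degree ≤ d} → K) :=
    { toFun := fun g p => coeff p.2.1 (g.1 p.1)
      map_add' := by intro a b; ext p; simp
      map_smul' := by intro a b; ext p; simp }
  refine FiniteDimensional.of_injective φ ?_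
  intro a b hab
  ext i ν
  by_cases hν : ν.degree ≤ d
  · exact congrFun hab (i, ⟨ν, hν⟩)
  · have hz : ∀ g : strandF K m r e d, coeff ν (g.1 i) = 0 := by
      intro g
      by_contra hc
      have := g.2 i ν hc
      rw [tdeg_eq_degree] at this
      omega
    rw [hz a, hz b]

/-- **Lemma (paper, Lemma 3.3; a version of Macaulay's theorem).** If `U` is a graded
submodule of the graded free module `F = ⊕ᵢ P₀ uᵢ` (`deg uᵢ = eᵢ`), then `F/U` and
`F/in(U)` have the same Hilbert function: `dim_K (F/U)_d = dim_K (F/in(U))_d` for all `d`. -/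
theorem hilbert_function_of_initial_module
    (e : Fin r → ℕ)
    (U : Submodule (MvPolynomial (Fin m) K) (Fin r →₀ MvPolynomial (Fin m) K))
    (hgraded : U = Submodule.span (MvPolynomial (Fin m) K)
      {g | g ∈ U ∧ ∃ d : ℕ, g ∈ strandF K m r e d})
    (d : ℕ) :
    Module.finrank K ↥(Submodule.map (U.mkQ.restrictScalars K) (strandF K m r e d)) =
      Module.finrank K
        ↥(Submodule.map ((iniSub K m r U).mkQ.restrictScalars K) (strandF K m r e d)) := by
  haveI := strandF_finite K m r e d
  have e1 := finrank_map_add_inf K (U.mkQ.restrictScalars K) (strandF K m r e d)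
  have e2 := finrank_map_add_inf K ((iniSub K m r U).mkQ.restrictScalars K) (strandF K m r e d)
  have e3 : Module.finrank K ↥(strandF K m r e d ⊓ LinearMap.ker (U.mkQ.restrictScalars K)) =
      Module.finrank K
        ↥(strandF K m r e d ⊓ LinearMap.ker ((iniSub K m r U).mkQ.restrictScalars K)) := by
    apply finrank_eq_of_lead K r
    intro j a
    simp only [Submodule.mem_inf, LinearMap.mem_ker, LinearMap.coe_restrictScalars,
      Submodule.mkQ_apply, Submodule.Quotient.mk_eq_zero]
    constructor
    · rintro ⟨g, ⟨hgV, hgU⟩, h1, rfl⟩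
      refine ⟨Finsupp.single j (g j), ⟨?_, ?_⟩, fun i hi => ?_, by simp⟩
      · intro i ν hν
        by_cases hij : j = i
        · subst hij
          rw [Finsupp.single_eq_same] at hν
          exact hgV _ _ hν
        · simp [Finsupp.single_apply, hij] at hν
      · by_cases hz : g j = 0
        · rw [hz, Finsupp.single_zero]
          exact Submodule.zero_mem _
        · exact Submodule.subset_span ⟨g, hgU, j, hz, h1, rfl⟩
      · simp [Finsupp.single_apply, hi.ne']
    · rintro ⟨h, ⟨hV, hI⟩, _, rfl⟩
      obtain ⟨g, hgU, h1, h2⟩ := iniSub_lead K m r U h hI j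
      refine ⟨comp K m r e d g, ⟨comp_mem K m r e d g,
        comp_mem_of_graded K m r e U hgraded d g hgU⟩, fun i hi => ?_, ?_⟩
      · ext ν
        rw [coeff_comp, h1 i hi]
        simp
      · ext ν
        rw [coeff_comp, h2]
        split_ifs with hc
        · rfl
        · by_contra hne
          exact hc (hV j ν (Ne.symm hne))
  omega

end Paper
end

section
/- Let K be a field, P_0 = K[x_1,…,x_m], and M a finitely generated graded Cohen–Macaulay P_0-module whose minimal graded free resolution is pure of the form 0 → P_0^{β_s}(−d_s) → ⋯ → P_0^{β_1}(−d_1) → P_0^{β_0} → M → 0, where s = codim M. Then for every i = 1,…,s, β_i = (−1)^{i+1} β_0 ∏_{j ≠ i, 1 ≤ j ≤ s} d_j/(d_j − d_i). -/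
/-!
Formalization of the Herzog–Kühl-type formulas (Propositions 4.6 and 4.7) of "On the
regularity of local cohomology of bigraded algebras" (A. Rahimi): for a finitely generated
graded Cohen–Macaulay module `M` over `P₀ = K[x₁,…,x_m]` with a pure minimal graded free
resolution `0 → P₀^{β_s}(-d_s) → ⋯ → P₀^{β_1}(-d_1) → P₀^{β_0} → M → 0`, `s = codim M`
(note that exactness of such a resolution of length `s` together with `codim M = s` is
equivalent to `M` being Cohen–Macaulay of codimension `s`, by Auslander–Buchsbaum).
-/

open MvPolynomial

namespace Paper

variable (K : Type) [Field K] (m : ℕ)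

/-- The degree-`e` strand of the graded free module `⊕_{s : τ} P₀(-a s)`. -/
def strandG {τ : Type} (a : τ → ℕ) (e : ℤ) :
    Submodule K (τ →₀ MvPolynomial (Fin m) K) where
  carrier := {w | ∀ s ν, MvPolynomial.coeff ν (w s) ≠ 0 → (tdeg ν : ℤ) + a s = e}
  add_mem' := by
    intro x y hx hy s ν h
    rw [Finsupp.add_apply, MvPolynomial.coeff_add] at h
    by_cases h1 : MvPolynomial.coeff ν (x s) ≠ 0
    · exact hx s ν h1
    · push_neg at h1
      exact hy s ν (by simpa [h1] using h)
  zero_mem' := by intro s ν h; simp at h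
  smul_mem' := by
    intro k w hw s ν h
    rw [Finsupp.smul_apply, MvPolynomial.coeff_smul] at h
    exact hw s ν (right_ne_zero_of_smul h)


theorem krull_aux {B A : Type} [CommRing B] [CommRing A] [Algebra B A] [Algebra.IsIntegral B A]
    [FaithfulSMul B A] : ringKrullDim B ≤ ringKrullDim A := by
  unfold ringKrullDim Order.krullDim
  refine iSup_le fun l => ?_
  obtain ⟨Q, _, hQp, hQ⟩ := Ideal.exists_ideal_over_prime_of_isIntegral (S := A)
    l.head.asIdeal ⊥ (by
      rw [← RingHom.ker_eq_comap_bot, (RingHom.injective_iff_ker_eq_bot _).1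
        (FaithfulSMul.algebraMap_injective B A)]
      exact bot_le)
  have : Q.LiesOver l.head.asIdeal := ⟨hQ.symm⟩
  obtain ⟨L, hL, -⟩ := Ideal.exists_ltSeries_of_hasGoingUp (S := A) l Q
  rw [← hL]
  exact le_iSup (fun p : LTSeries (PrimeSpectrum A) => (p.length : WithBot ℕ∞)) L

theorem finrank_rtd (K : Type) [Field K] (m n : ℕ) :
    Module.finrank K (restrictTotalDegree (Fin m) K n) = (n + m).choose m := by
  classical
  have h1 := Module.finrank_eq_nat_card_basis
    (basisRestrictSupport K {ν : Fin m →₀ ℕ | (ν.sum fun _ e => e) ≤ n})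
  refine h1.trans ?_
  have h2 : {ν : Fin m →₀ ℕ | (ν.sum fun _ e => e) ≤ n} =
      ((Finset.range (n+1)).biUnion fun k => Finset.finsuppAntidiag Finset.univ k :
        Finset (Fin m →₀ ℕ)) := by
    ext ν
    simp [Finset.mem_finsuppAntidiag, Finsupp.sum_fintype]
  rw [h2, Nat.card_eq_fintype_card]
  simp only [Finset.coe_sort_coe, Fintype.card_coe]
  rw [Finset.card_biUnion]
  · simp only [Finset.card_finsuppAntidiag_nat_eq_multichoose, Finset.card_univ, Fintype.card_fin]
    rw [Nat.choose_symm_add.symm]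
    clear h1 h2
    induction n with
    | zero => simp
    | succ n ih =>
      rw [Finset.sum_range_succ, ih, Nat.multichoose_eq]
      have : n + 1 + m = (n + m) + 1 := by ring
      rw [this, Nat.choose_succ_succ, show m + (n+1) - 1 = n + m by omega]
  · intro a _ b _ hab
    refine Finset.disjoint_left.2 fun x hx hy => hab ?_
    rw [Finset.mem_finsuppAntidiag] at hx hy
    exact hx.1.symm.trans hy.1

open Polynomial in
theorem functional_vanish {ι : Type} (S : Finset ι) (c a : ι → ℚ) (s : ℕ) (h : ℕ → ℚ[X])
    (hdeg : ∀ k < s, (h k).degree = k) (hv : ∀ k < s, ∑ i ∈ S, c i * (h k).eval (a i) = 0) :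
    ∀ k ≤ s, ∀ f : ℚ[X], f.degree < k → ∑ i ∈ S, c i * f.eval (a i) = 0 := by
  intro k
  induction k with
  | zero =>
    intro _ f hf
    have : f = 0 := by simpa using hf
    simp [this]
  | succ k ih =>
    intro hk f hf
    have hk' : k < s := hk
    have hh0 : (h k).coeff k ≠ 0 := by
      have := hdeg k hk'
      exact Polynomial.coeff_ne_zero_of_eq_degree this
    set g := f - Polynomial.C (f.coeff k / (h k).coeff k) * h k with hg
    have hgd : g.degree < k := by
      rw [Polynomial.degree_lt_iff_coeff_zero]
      intro n hn
      rcases eq_or_lt_of_le hn with rfl | hn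
      · simp [hg, hh0]
      · have e1 : f.coeff n = 0 := Polynomial.coeff_eq_zero_of_degree_lt
          (hf.trans_le (by exact_mod_cast hn))
        have e2 : (h k).coeff n = 0 := Polynomial.coeff_eq_zero_of_degree_lt
          (by rw [hdeg k hk']; exact_mod_cast hn)
        simp [hg, e1, e2]
    have e := ih (by omega) g hgd
    have e3 := hv k hk'
    have : ∑ i ∈ S, c i * f.eval (a i) = ∑ i ∈ S, c i * g.eval (a i) +
        (f.coeff k / (h k).coeff k) * ∑ i ∈ S, c i * (h k).eval (a i) := by
      rw [Finset.mul_sum, ← Finset.sum_add_distrib]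
      refine Finset.sum_congr rfl fun i _ => ?_
      simp [hg]; ring
    rw [this, e, e3]; simp

open Polynomial Filter in
theorem degree_le_of_bound (q : ℚ[X]) (r : ℕ) (c : ℚ) (N : ℕ)
    (h : ∀ n : ℕ, N ≤ n → |q.eval (n:ℚ)| ≤ c * (n:ℚ)^r) : q.degree ≤ r := by
  by_contra hlt
  push Not at hlt
  have := Polynomial.abs_div_tendsto_atTop_atTop_of_degree_gt q (Polynomial.X^r) (by simpa using hlt)
    (by simp)
  have h2 := (this.comp (tendsto_natCast_atTop_atTop (R := ℚ))).eventually_gt_atTop c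
  obtain ⟨n, hn, hn1, hn2⟩ := (h2.and ((eventually_ge_atTop N).and (eventually_ge_atTop 1))).exists
  have := h n hn1
  have hp : (0:ℚ) < (n:ℚ)^r := by positivity
  simp only [Function.comp, Polynomial.eval_pow, Polynomial.eval_X, abs_div, abs_of_pos hp] at hn
  rw [lt_div_iff₀ hp] at hn
  linarith

/-- Numerical part: the alternating sum of binomials growing slowly gives moments. -/
theorem moments {m s r : ℕ} (hr : r + s ≤ m) (c : ℕ → ℚ) (d : ℕ → ℕ) (S : Finset ℕ) (N : ℕ)
    (hN : ∀ i ∈ S, d i ≤ N) (b : ℚ)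
    (h : ∀ n : ℕ, N ≤ n → |∑ i ∈ S, c i * ((n - d i + m).choose m : ℚ)| ≤ b * (n:ℚ)^r)
    (f : Polynomial ℚ) (hf : f.degree < s) : ∑ i ∈ S, c i * f.eval (d i : ℚ) = 0 := by
  open Polynomial in
  set q : ℚ[X] := ∑ i ∈ S, Polynomial.C (c i) * preHilbertPoly ℚ m (d i) with hq
  have hqd : q.degree ≤ r := by
    refine degree_le_of_bound q r b N fun n hn => ?_
    convert h n hn using 2
    rw [hq, Polynomial.eval_finsetSum]
    refine Finset.sum_congr rfl fun i hi => ?_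
    rw [Polynomial.eval_mul, Polynomial.eval_C, Polynomial.preHilbertPoly_eq_choose_sub_add ℚ _
      ((hN i hi).trans hn)]
  set g := Polynomial.preHilbertPoly ℚ m 0
  have hg : ∀ k : ℕ, Polynomial.preHilbertPoly ℚ m k = Polynomial.taylor (-(k:ℚ)) g := by
    intro k
    simp only [g, Polynomial.preHilbertPoly, Polynomial.taylor_apply, Polynomial.smul_comp,
      Polynomial.comp_assoc]
    congr 2
    simp [sub_eq_add_neg]
  have key := functional_vanish S c (fun i => -(d i : ℚ)) s
    (fun k => Polynomial.hasseDeriv (m - k) g)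
    (by
      intro k hk
      have h1 : (Polynomial.hasseDeriv (m-k) g).natDegree = k := by
        rw [Polynomial.natDegree_hasseDeriv, Polynomial.natDegree_preHilbertPoly]; omega
      have h2 : (Polynomial.hasseDeriv (m-k) g).coeff k ≠ 0 := by
        rw [Polynomial.hasseDeriv_coeff, show k + (m-k) = m by omega,
          Polynomial.coeff_preHilbertPoly_self]
        have : m.choose (m-k) ≠ 0 := (Nat.choose_pos (by omega)).ne'
        have : (m.factorial : ℚ) ≠ 0 := by exact_mod_cast m.factorial_ne_zero
        positivity
      refine le_antisymm (Polynomial.natDegree_le_iff_degree_le.1 h1.le)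
        (Polynomial.le_degree_of_ne_zero h2))
    (by
      intro k hk
      have : q.coeff (m-k) = 0 := Polynomial.coeff_eq_zero_of_degree_lt
        (hqd.trans_lt (by exact_mod_cast (by omega : r < m - k)))
      rw [hq, Polynomial.finsetSum_coeff] at this
      rw [← this]
      refine Finset.sum_congr rfl fun i _ => ?_
      rw [Polynomial.coeff_C_mul, hg, Polynomial.taylor_coeff])
    s le_rfl (f.comp (-Polynomial.X)) (by rwa [Polynomial.degree_comp_neg_X])
  simpa using key

theorem final_formula {s : ℕ} (β d : ℕ → ℕ) (hd0 : d 0 = 0)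
    (hinj : ∀ i ∈ Finset.Icc 1 s, ∀ j ∈ Finset.Icc 1 s, d i = d j → i = j)
    (h : ∀ f : Polynomial ℚ, f.degree < s →
      ∑ i ∈ Finset.range (s+1), (-1:ℚ)^i * (β i : ℚ) * f.eval (d i : ℚ) = 0)
    (i : ℕ) (hi1 : 1 ≤ i) (his : i ≤ s) :
    (β i : ℚ) = (-1 : ℚ) ^ (i + 1) * (β 0 : ℚ) *
      ∏ j ∈ (Finset.Icc 1 s).erase i, ((d j : ℚ) / ((d j : ℚ) - (d i : ℚ))) := by
  have hmem : i ∈ Finset.Icc 1 s := Finset.mem_Icc.2 ⟨hi1, his⟩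
  have h1 := h (∏ j ∈ (Finset.Icc 1 s).erase i, (Polynomial.C (d j : ℚ) - Polynomial.X)) (by
    refine (Polynomial.degree_prod_le _ _).trans_lt ?_
    refine (Finset.sum_le_card_nsmul _ _ 1 ?_).trans_lt ?_
    · intro j _
      rw [← Polynomial.degree_neg, neg_sub]
      exact (Polynomial.degree_X_sub_C _).le
    · rw [Finset.card_erase_of_mem hmem]
      simp only [Nat.card_Icc, nsmul_eq_mul, mul_one]
      exact_mod_cast (by omega : s + 1 - 1 - 1 < s))
  simp only [Polynomial.eval_prod, Polynomial.eval_sub, Polynomial.eval_C, Polynomial.eval_X] at h1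
  rw [Finset.sum_range_succ', Finset.sum_eq_single (i-1)] at h1
  · rw [show i - 1 + 1 = i by omega] at h1
    simp only [hd0, pow_zero, one_mul, Nat.cast_zero, sub_zero] at h1
    rw [Finset.prod_div_distrib]
    have hne : ∏ j ∈ (Finset.Icc 1 s).erase i, ((d j : ℚ) - (d i : ℚ)) ≠ 0 := by
      rw [Finset.prod_ne_zero_iff]
      intro j hj hz
      rw [Finset.mem_erase] at hj
      exact hj.1 (hinj j hj.2 i hmem (by exact_mod_cast sub_eq_zero.1 hz))
    rw [← mul_div_assoc, eq_div_iff hne, pow_succ]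
    have hs : ((-1:ℚ)^i) * ((-1:ℚ)^i) = 1 := by rw [← mul_pow]; simp
    linear_combination (-1:ℚ)^i * h1 - (β i : ℚ) * (∏ j ∈ (Finset.Icc 1 s).erase i, ((d j : ℚ) - (d i : ℚ))) * hs
  · intro j hj hji
    refine mul_eq_zero_of_right _ (Finset.prod_eq_zero (i := j+1) ?_ (sub_self _))
    rw [Finset.mem_erase, Finset.mem_Icc]
    rw [Finset.mem_range] at hj
    omega
  · intro hni
    rw [Finset.mem_range] at hni
    omega
theorem krull_hom {B A : Type} [CommRing B] [CommRing A] (g : B →+* A)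
    (hg : Function.Injective g) (hfin : g.Finite) : ringKrullDim B ≤ ringKrullDim A := by
  let _ := g.toAlgebra
  have : Module.Finite B A := hfin
  have : FaithfulSMul B A := (faithfulSMul_iff_algebraMap_injective _ _).2 hg
  exact krull_aux

theorem gens_hom {B A : Type} [CommRing B] [CommRing A] (g : B →+* A) (hfin : g.Finite) :
    ∃ (N : ℕ) (a : Fin N → A), ∀ x, ∃ b : Fin N → B, x = ∑ k, g (b k) * a k := by
  let _ := g.toAlgebra
  have : Module.Finite B A := hfin
  obtain ⟨N, a, ha⟩ := Module.Finite.exists_fin (R := B) (M := A)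
  refine ⟨N, a, fun x => ?_⟩
  have hx : x ∈ Submodule.span B (Set.range a) := ha ▸ trivial
  obtain ⟨b, hb⟩ := (Submodule.mem_span_range_iff_exists_fun _).1 hx
  exact ⟨b, hb.symm⟩

theorem finrank_range_pi_le {K B A : Type} [Field K] [AddCommGroup B] [Module K B]
    [AddCommGroup A] [Module K A] {N : ℕ} (V : Submodule K B) [Module.Finite K V]
    (φ : Fin N → B →ₗ[K] A) (W : Submodule K A)
    (hW : ∀ x ∈ W, ∃ b : Fin N → B, (∀ k, b k ∈ V) ∧ x = ∑ k, φ k (b k)) :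
    Module.finrank K W ≤ N * Module.finrank K V := by
  let Λ : (Fin N → V) →ₗ[K] A := LinearMap.lsum K (fun _ => V) K (fun k => (φ k).comp V.subtype)
  have hle : W ≤ LinearMap.range Λ := by
    intro x hx
    obtain ⟨b, hb, rfl⟩ := hW x hx
    exact ⟨fun k => ⟨b k, hb k⟩, by simp [Λ, LinearMap.lsum_apply]⟩
  refine (Submodule.finrank_mono hle).trans ((LinearMap.finrank_range_le Λ).trans ?_)
  rw [Module.finrank_pi_fintype]
  simp

theorem growth (K : Type) [Field K] (m : ℕ) (I : Ideal (MvPolynomial (Fin m) K)) (r : ℕ)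
    (hr : ringKrullDim (MvPolynomial (Fin m) K ⧸ I) = (r : WithBot ℕ∞)) :
    ∃ c : ℕ, ∀ n : ℕ, 1 ≤ n → Module.finrank K
      ((restrictTotalDegree (Fin m) K n).map (Ideal.Quotient.mkₐ K I).toLinearMap) ≤ c * n ^ r := by
  classical
  have hnt : Nontrivial (MvPolynomial (Fin m) K ⧸ I) := by
    by_contra h
    rw [not_nontrivial_iff_subsingleton] at h
    rw [ringKrullDim_eq_bot_of_subsingleton] at hr
    exact absurd hr (by simp)
  obtain ⟨r', g, hg, hfin⟩ := exists_finite_inj_algHom_of_fg K (MvPolynomial (Fin m) K ⧸ I)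
  have hrr : r' ≤ r := by
    have := krull_hom g.toRingHom hg hfin
    rw [hr, MvPolynomial.ringKrullDim_of_isNoetherianRing, ringKrullDim_eq_zero_of_field] at this
    simpa using this
  obtain ⟨N, a, ha⟩ := gens_hom g.toRingHom hfin
  replace ha : ∀ x, ∃ b : Fin N → MvPolynomial (Fin r') K, x = ∑ k, g (b k) * a k := ha
  obtain ⟨b0, hb0⟩ := ha 1
  choose b hb using fun (i : Fin m) (j : Fin N) => ha (Ideal.Quotient.mk I (X i) * a j)
  obtain ⟨D, hD0, hD⟩ : ∃ D : ℕ, (∀ k, (b0 k).totalDegree ≤ D) ∧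
      ∀ i j k, (b i j k).totalDegree ≤ D := by
    refine ⟨(∑ k, (b0 k).totalDegree) + ∑ i, ∑ j, ∑ k, (b i j k).totalDegree, ?_, ?_⟩
    · intro k
      exact (Finset.single_le_sum (f := fun k => (b0 k).totalDegree)
        (fun _ _ => Nat.zero_le _) (Finset.mem_univ k)).trans (Nat.le_add_right _ _)
    · intro i j k
      refine le_trans ?_ (Nat.le_add_left _ _)
      refine le_trans ?_ (Finset.single_le_sum (f := fun i => ∑ j, ∑ k, (b i j k).totalDegree)
        (fun _ _ => Nat.zero_le _) (Finset.mem_univ i))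
      refine le_trans ?_ (Finset.single_le_sum (f := fun j => ∑ k, (b i j k).totalDegree)
        (fun _ _ => Nat.zero_le _) (Finset.mem_univ j))
      exact (Finset.single_le_sum (f := fun k => (b i j k).totalDegree)
        (fun _ _ => Nat.zero_le _) (Finset.mem_univ k))
  -- monomials
  have hmon : ∀ n : ℕ, ∀ ν : Fin m →₀ ℕ, (ν.sum fun _ e => e) ≤ n →
      ∃ b : Fin N → MvPolynomial (Fin r') K, (∀ k, (b k).totalDegree ≤ (n+1) * D) ∧
        Ideal.Quotient.mk I (monomial ν 1) = ∑ k, g (b k) * a k := by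
    intro n
    induction n with
    | zero =>
      intro ν hν
      have hν0 : ν = 0 := by
        ext i
        by_contra hi
        rw [Finsupp.sum_fintype _ _ (by simp)] at hν
        have := Finset.single_le_sum (f := fun i => ν i)
          (fun _ _ => Nat.zero_le _) (Finset.mem_univ i)
        simp at hi; omega
      subst hν0
      exact ⟨b0, by simpa using hD0, by simpa using hb0⟩
    | succ n ih =>
      intro ν hν
      by_cases hν0 : ν = 0
      · subst hν0
        exact ⟨b0, fun k => (hD0 k).trans (Nat.le_mul_of_pos_left _ (by omega)), by simpa using hb0⟩
      · obtain ⟨i, hi⟩ := Finsupp.ne_iff.1 hν0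
        have hi' : Finsupp.single i 1 ≤ ν := by
          rw [Finsupp.single_le_iff]
          exact Nat.one_le_iff_ne_zero.2 hi
        obtain ⟨μ, rfl⟩ := exists_add_of_le hi'
        rw [Finsupp.sum_add_index' (by simp) (by simp), Finsupp.sum_single_index rfl] at hν
        obtain ⟨e, he, hee⟩ := ih μ (by omega)
        refine ⟨fun k => ∑ j, e j * b i j k, fun k => ?_, ?_⟩
        · refine totalDegree_finsetSum_le fun j _ => ?_
          refine (totalDegree_mul _ _).trans ?_
          have := he j
          have := hD i j k
          nlinarith
        · have : (monomial (Finsupp.single i 1 + μ) (1:K)) = X i * monomial μ 1 := by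
            rw [X, monomial_mul, one_mul]
          rw [this, map_mul, hee, Finset.mul_sum]
          simp only [map_sum, map_mul, Finset.sum_mul]
          rw [Finset.sum_comm]
          refine Finset.sum_congr rfl fun j _ => ?_
          rw [mul_left_comm, hb, Finset.mul_sum]
          refine Finset.sum_congr rfl fun k _ => by ring
  refine ⟨N * (2 * D + r') ^ r', fun n hn => ?_⟩
  have h1 := finrank_range_pi_le (restrictTotalDegree (Fin r') K ((n+1)*D))
    (fun k => (LinearMap.mulRight K (a k)).comp g.toLinearMap)
    ((restrictTotalDegree (Fin m) K n).map (Ideal.Quotient.mkₐ K I).toLinearMap) (by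
      rintro _ ⟨p, hp, rfl⟩
      have hp' : p ∈ restrictTotalDegree (Fin m) K n := hp
      rw [restrictTotalDegree, restrictSupport_eq_span] at hp'
      clear hp
      induction hp' using Submodule.span_induction with
      | mem x hx =>
        obtain ⟨ν, hν, rfl⟩ := hx
        obtain ⟨e, he, hee⟩ := hmon n ν hν
        exact ⟨e, fun k => (mem_restrictTotalDegree _ _ _).2 (he k), by simpa using hee⟩
      | zero => exact ⟨0, fun k => Submodule.zero_mem _, by simp⟩
      | add x y _ _ hx hy =>
        obtain ⟨e, he, hee⟩ := hx
        obtain ⟨f, hf, hff⟩ := hy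
        exact ⟨e + f, fun k => Submodule.add_mem _ (he k) (hf k), by
          rw [map_add, hee, hff, ← Finset.sum_add_distrib]; simp [add_mul]⟩
      | smul c x _ hx =>
        obtain ⟨e, he, hee⟩ := hx
        exact ⟨c • e, fun k => Submodule.smul_mem _ _ (he k), by
          rw [map_smul, hee, Finset.smul_sum]; simp⟩)
  rw [finrank_rtd] at h1
  refine h1.trans ?_
  rw [mul_assoc]
  refine Nat.mul_le_mul_left _ ?_
  refine (Nat.choose_le_pow _ _).trans ?_
  calc ((n+1)*D + r')^r' ≤ ((2 * D + r') * n)^r' := Nat.pow_le_pow_left (by nlinarith) _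
    _ = (2*D+r')^r' * n^r' := mul_pow _ _ _
    _ ≤ _ := Nat.mul_le_mul_left _ (Nat.pow_le_pow_right hn hrr)

theorem growth_module (K : Type) [Field K] (m : ℕ) (M : Type) [AddCommGroup M]
    [Module K M] [Module (MvPolynomial (Fin m) K) M]
    [IsScalarTower K (MvPolynomial (Fin m) K) M] (r : ℕ)
    (hr : ringKrullDim ((MvPolynomial (Fin m) K) ⧸
        Module.annihilator (MvPolynomial (Fin m) K) M) = (r : WithBot ℕ∞)) (N : ℕ)
    (ε : (Fin N →₀ MvPolynomial (Fin m) K) →ₗ[MvPolynomial (Fin m) K] M) :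
    ∃ c : ℕ, ∀ n : ℕ, 1 ≤ n → ∀ F : Submodule K (Fin N →₀ MvPolynomial (Fin m) K),
      (∀ w ∈ F, ∀ t, w t ∈ restrictTotalDegree (Fin m) K n) →
      Module.finrank K (F.map (ε.restrictScalars K)) ≤ c * n ^ r := by
  obtain ⟨c, hc⟩ := growth K m _ r hr
  refine ⟨N * c, fun n hn F hF => ?_⟩
  set I := Module.annihilator (MvPolynomial (Fin m) K) M
  have hI : ∀ x : M, I ≤ LinearMap.ker (LinearMap.toSpanSingleton (MvPolynomial (Fin m) K) M x) := by
    intro x p hp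
    simpa using Module.mem_annihilator.1 hp x
  let φ : Fin N → ((MvPolynomial (Fin m) K ⧸ I) →ₗ[K] M) := fun t =>
    (Submodule.liftQ I (LinearMap.toSpanSingleton (MvPolynomial (Fin m) K) M
      (ε (Finsupp.single t 1))) (hI _)).restrictScalars K
  have h1 := finrank_range_pi_le
    ((restrictTotalDegree (Fin m) K n).map (Ideal.Quotient.mkₐ K I).toLinearMap) φ
    (F.map (ε.restrictScalars K)) (by
      rintro _ ⟨w, hw, rfl⟩
      refine ⟨fun t => Ideal.Quotient.mk I (w t), fun t => ⟨w t, hF w hw t, rfl⟩, ?_⟩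
      have hw2 : w = ∑ t, w t • Finsupp.single t (1 : MvPolynomial (Fin m) K) := by
        simp [Finsupp.univ_sum_single]
      conv_lhs => rw [hw2]
      rw [map_sum]
      refine Finset.sum_congr rfl fun t _ => ?_
      change ε (w t • _) = w t • ε _
      rw [map_smul])
  refine h1.trans ?_
  rw [mul_assoc]
  exact Nat.mul_le_mul_left _ (hc n hn)
/-- The part of degree at most `n` of `P(-a)^b`. -/
def filt (K : Type) [Field K] (m b a n : ℕ) : Submodule K (Fin b →₀ MvPolynomial (Fin m) K) where
  carrier := {w | ∀ t ν, coeff ν (w t) ≠ 0 → tdeg ν + a ≤ n}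
  add_mem' := by
    intro x y hx hy t ν h
    rw [Finsupp.add_apply, coeff_add] at h
    by_cases h1 : coeff ν (x t) ≠ 0
    · exact hx t ν h1
    · push Not at h1
      exact hy t ν (by simpa [h1] using h)
  zero_mem' := by intro t ν h; simp at h
  smul_mem' := by
    intro k w hw t ν h
    rw [Finsupp.smul_apply, coeff_smul] at h
    exact hw t ν (right_ne_zero_of_smul h)

theorem filt_mem_rtd {K : Type} [Field K] {m b a n : ℕ} {w : Fin b →₀ MvPolynomial (Fin m) K}
    (hw : w ∈ filt K m b a n) (t : Fin b) : w t ∈ restrictTotalDegree (Fin m) K (n - a) := by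
  rw [mem_restrictTotalDegree, totalDegree, Finset.sup_le_iff]
  intro ν hν
  have := hw t ν (mem_support_iff.1 hν)
  unfold tdeg at this
  omega

theorem mem_filt_of_rtd {K : Type} [Field K] {m b a n : ℕ} (han : a ≤ n)
    {w : Fin b →₀ MvPolynomial (Fin m) K}
    (hw : ∀ t, w t ∈ restrictTotalDegree (Fin m) K (n - a)) : w ∈ filt K m b a n := by
  intro t ν hν
  have := hw t
  rw [mem_restrictTotalDegree, totalDegree, Finset.sup_le_iff] at this
  have := this ν (mem_support_iff.2 hν)
  unfold tdeg
  omega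

/-- `filt` as a power of the polynomials of bounded degree. -/
noncomputable def filtEquiv (K : Type) [Field K] (m b a n : ℕ) (han : a ≤ n) :
    filt K m b a n ≃ₗ[K] (Fin b → restrictTotalDegree (Fin m) K (n - a)) where
  toFun w t := ⟨w.1 t, filt_mem_rtd w.2 t⟩
  map_add' _ _ := rfl
  map_smul' _ _ := rfl
  invFun v := ⟨Finsupp.equivFunOnFinite.symm (fun t => (v t).1),
    mem_filt_of_rtd han fun t => (v t).2⟩
  left_inv w := by ext; simp
  right_inv v := by ext; simp

theorem finite_filt (K : Type) [Field K] (m b a n : ℕ) (han : a ≤ n) :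
    Module.Finite K (filt K m b a n) := Module.Finite.equiv (filtEquiv K m b a n han).symm

theorem finrank_filt (K : Type) [Field K] (m b a n : ℕ) (han : a ≤ n) :
    Module.finrank K (filt K m b a n) = b * (n - a + m).choose m := by
  rw [(filtEquiv K m b a n han).finrank_eq, Module.finrank_pi_fintype]
  simp [finrank_rtd]

/-- Truncation of polynomials. -/
noncomputable def trunc1 (K : Type) [Field K] (m a n : ℕ) :
    MvPolynomial (Fin m) K →ₗ[K] MvPolynomial (Fin m) K :=
  (basisMonomials (Fin m) K).constr K
    (fun ν => if tdeg ν + a ≤ n then monomial ν 1 else 0)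

theorem trunc1_monomial (K : Type) [Field K] (m a n : ℕ) (ν : Fin m →₀ ℕ) (c : K) :
    trunc1 K m a n (monomial ν c) = if tdeg ν + a ≤ n then monomial ν c else 0 := by
  have h1 := (basisMonomials (Fin m) K).constr_basis K
    (fun ν => if tdeg ν + a ≤ n then monomial ν (1:K) else 0) ν
  rw [coe_basisMonomials] at h1
  have h2 : monomial ν c = c • monomial ν (1:K) := by rw [smul_monomial]; simp
  rw [h2, map_smul, trunc1, h1]
  split_ifs <;> simp

theorem coeff_trunc1 (K : Type) [Field K] (m a n : ℕ) (p : MvPolynomial (Fin m) K)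
    (ν : Fin m →₀ ℕ) :
    coeff ν (trunc1 K m a n p) = if tdeg ν + a ≤ n then coeff ν p else 0 := by
  classical
  induction p using MvPolynomial.induction_on' with
  | monomial μ c =>
    rw [trunc1_monomial]
    by_cases h : μ = ν
    · subst h
      split_ifs <;> simp
    · rw [coeff_monomial, if_neg h]
      split_ifs <;> simp [coeff_monomial, h]
  | add p q hp hq =>
    rw [map_add, coeff_add, hp, hq, coeff_add]
    split_ifs <;> simp

/-- Truncation of vectors. -/
noncomputable def trunc (K : Type) [Field K] (m b a n : ℕ) :
    (Fin b →₀ MvPolynomial (Fin m) K) →ₗ[K] (Fin b →₀ MvPolynomial (Fin m) K) :=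
  Finsupp.mapRange.linearMap (trunc1 K m a n)

theorem coeff_trunc (K : Type) [Field K] (m b a n : ℕ) (w : Fin b →₀ MvPolynomial (Fin m) K)
    (t : Fin b) (ν : Fin m →₀ ℕ) :
    coeff ν (trunc K m b a n w t) = if tdeg ν + a ≤ n then coeff ν (w t) else 0 := by
  rw [trunc, Finsupp.mapRange.linearMap_apply, Finsupp.mapRange_apply, coeff_trunc1]

theorem trunc_mem (K : Type) [Field K] (m b a n : ℕ) (w : Fin b →₀ MvPolynomial (Fin m) K) :
    trunc K m b a n w ∈ filt K m b a n := by
  intro t ν h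
  rw [coeff_trunc] at h
  by_contra h'
  simp [h'] at h

theorem trunc_eq (K : Type) [Field K] (m b a n : ℕ) (w : Fin b →₀ MvPolynomial (Fin m) K)
    (hw : w ∈ filt K m b a n) : trunc K m b a n w = w := by
  ext t ν
  rw [coeff_trunc]
  split_ifs with h
  · rfl
  · by_contra h'
    exact h (hw t ν (Ne.symm h'))

theorem trunc_comm (K : Type) [Field K] (m b b' a a' n : ℕ)
    (f : (Fin b →₀ MvPolynomial (Fin m) K) →ₗ[MvPolynomial (Fin m) K]
      (Fin b' →₀ MvPolynomial (Fin m) K))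
    (hf : ∀ s t ν, coeff ν (f (Finsupp.single s 1) t) ≠ 0 → tdeg ν + a' = a)
    (w : Fin b →₀ MvPolynomial (Fin m) K) :
    f (trunc K m b a n w) = trunc K m b' a' n (f w) := by
  classical
  induction w using Finsupp.induction_linear with
  | zero => simp
  | add x y hx hy => simp only [map_add, hx, hy]
  | single i p =>
    induction p using MvPolynomial.induction_on' with
    | add p q hp hq => simp only [Finsupp.single_add, map_add, hp, hq]
    | monomial ν c =>
      have h1 : trunc K m b a n (Finsupp.single i (monomial ν c)) =
          if tdeg ν + a ≤ n then Finsupp.single i (monomial ν c) else 0 := by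
        rw [trunc, Finsupp.mapRange.linearMap_apply, Finsupp.mapRange_single, trunc1_monomial]
        split_ifs <;> simp
      have h2 : f (Finsupp.single i (monomial ν c)) =
          monomial ν c • f (Finsupp.single i 1) := by
        rw [← map_smul, Finsupp.smul_single, smul_eq_mul, mul_one]
      ext t μ
      rw [coeff_trunc, h1, apply_ite f, h2, map_zero]
      have h3 : coeff μ ((monomial ν c • f (Finsupp.single i 1)) t) ≠ 0 →
          tdeg μ + a' = tdeg ν + a := by
        rw [Finsupp.smul_apply, smul_eq_mul, coeff_monomial_mul']
        intro h
        split_ifs at h with hle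
        · obtain ⟨κ, rfl⟩ := exists_add_of_le hle
          rw [add_tsub_cancel_left] at h
          have h4 := hf i t κ (right_ne_zero_of_mul h)
          have h5 : tdeg (ν + κ) = tdeg ν + tdeg κ :=
            Finsupp.sum_add_index' (by simp) (by simp)
          omega
        · exact absurd rfl h
      by_cases h0 : coeff μ ((monomial ν c • f (Finsupp.single i 1)) t) = 0
      · rw [h0]; split_ifs <;> first | exact h0 | simp
      · have := h3 h0
        rw [this]
        split_ifs <;> simp

theorem rank_step {K U V W : Type} [Field K] [AddCommGroup U] [AddCommGroup V] [AddCommGroup W]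
    [Module K U] [Module K V] [Module K W] (f : U →ₗ[K] V) (g : V →ₗ[K] W)
    (hfg : Function.Exact f g) (F : Submodule K U) (G : Submodule K V) [Module.Finite K G]
    (TU : U → U) (TV : V → V) (hTU : ∀ u, TU u ∈ F) (hTU' : ∀ u ∈ F, TU u = u)
    (hTV : ∀ v, TV v ∈ G) (hTV' : ∀ v ∈ G, TV v = v)
    (hcomm : ∀ u, f (TU u) = TV (f u)) :
    Module.finrank K G = Module.finrank K (G.map g) + Module.finrank K (F.map f) := by
  have h1 : F.map f = G ⊓ LinearMap.ker g := by
    ext v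
    constructor
    · rintro ⟨u, hu, rfl⟩
      refine ⟨?_, (hfg _).2 ⟨u, rfl⟩⟩
      have := hcomm u
      rw [hTU' u hu] at this
      rw [this]; exact hTV _
    · rintro ⟨hv, hgv⟩
      obtain ⟨u, rfl⟩ := (hfg v).1 hgv
      exact ⟨TU u, hTU u, by rw [hcomm, hTV' _ hv]⟩
  have h2 := LinearMap.finrank_range_add_finrank_ker (g.domRestrict G)
  rw [LinearMap.range_domRestrict, LinearMap.ker_domRestrict] at h2
  rw [← h2, h1, ← Submodule.map_comap_subtype, Submodule.finrank_map_subtype_eq]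

theorem telescoping (A ρ : ℕ → ℚ) (k : ℕ) (h : ∀ i ≤ k, A i = ρ i + ρ (i+1)) :
    ∑ i ∈ Finset.range (k+1), (-1:ℚ)^i * A i = ρ 0 + (-1)^k * ρ (k+1) := by
  induction k with
  | zero => simp [h 0 le_rfl]
  | succ k ih =>
    rw [Finset.sum_range_succ, ih (fun i hi => h i (by omega)), h (k+1) le_rfl]
    ring
/-- **Proposition (paper, Proposition 4.6; extension of the Herzog–Kühl formulas).**
Let `M` be a finitely generated graded Cohen–Macaulay `P₀`-module with pure minimal graded
free resolution `0 → P₀^{β_s}(-d_s) → ⋯ → P₀^{β_1}(-d_1) → P₀^{β_0} → M → 0`,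
`s = codim M`.  Then `β_i = (-1)^{i+1} β_0 ∏_{j ≠ i} d_j/(d_j - d_i)` for `i = 1,…,s`. -/
theorem betti_numbers_of_pure_resolution
    (K : Type) [Field K] (m : ℕ)
    (M : Type) [AddCommGroup M]
    [Module K M] [Module (MvPolynomial (Fin m) K) M]
    [IsScalarTower K (MvPolynomial (Fin m) K) M]
    [Module.Finite (MvPolynomial (Fin m) K) M]
    -- a grading of `M`:
    (ℳ : ℤ → Submodule K M)
    (hdecomp : DirectSum.IsInternal ℳ)
    (hsmul : ∀ (e : ℕ) (p : MvPolynomial (Fin m) K), p.IsHomogeneous e →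
      ∀ (i : ℤ) (x : M), x ∈ ℳ i → p • x ∈ ℳ (i + e))
    -- a pure graded free resolution
    -- `0 → P₀^{β s}(-d s) → ⋯ → P₀^{β 1}(-d 1) → P₀^{β 0} → M → 0`,
    -- with `d 0 = 0 < d 1 < d 2 < ⋯ < d s` (purity forces minimality here):
    (s : ℕ) (β : ℕ → ℕ) (d : ℕ → ℕ)
    (hβ : ∀ i, s < i → β i = 0)
    (hd0 : d 0 = 0) (hd1 : 0 < d 1)
    (hdmono : ∀ i, 1 ≤ i → i < s → d i < d (i + 1))
    (ψ : ∀ i, ((Fin (β (i + 1))) →₀ MvPolynomial (Fin m) K) →ₗ[MvPolynomial (Fin m) K]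
      ((Fin (β i)) →₀ MvPolynomial (Fin m) K))
    (ε : ((Fin (β 0)) →₀ MvPolynomial (Fin m) K) →ₗ[MvPolynomial (Fin m) K] M)
    (hsurj : Function.Surjective ε)
    (hexact₀ : Function.Exact (ψ 0) ε)
    (hexact : ∀ i, Function.Exact (ψ (i + 1)) (ψ i))
    (hψgr : ∀ i s' t ν, MvPolynomial.coeff ν ((ψ i (Finsupp.single s' 1)) t) ≠ 0 →
      tdeg ν + d i = d (i + 1))
    (hεgr : ∀ t, ε (Finsupp.single t 1) ∈ ℳ 0)
    -- `M` is Cohen–Macaulay of codimension `s`: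
    (hs : s ≤ m)
    (hcodim : ringKrullDim ((MvPolynomial (Fin m) K) ⧸
        Module.annihilator (MvPolynomial (Fin m) K) M) = ((m - s : ℕ) : WithBot ℕ∞))
    (i : ℕ) (hi1 : 1 ≤ i) (his : i ≤ s) :
    (β i : ℚ) = (-1 : ℚ) ^ (i + 1) * (β 0 : ℚ) *
      ∏ j ∈ (Finset.Icc 1 s).erase i, ((d j : ℚ) / ((d j : ℚ) - (d i : ℚ))) := by
  have hmono : ∀ i j, 1 ≤ i → i < j → j ≤ s → d i < d j := by
    intro i j h1 hij hjs
    induction j with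
    | zero => omega
    | succ j ih =>
      have h2 := hdmono j (by omega) (by omega)
      rcases Nat.lt_succ_iff_lt_or_eq.1 hij with h | h
      · exact (ih h (by omega)).trans h2
      · subst h; exact h2
  refine final_formula β d hd0 ?_ ?_ i hi1 his
  · intro i hi j hj hij
    rw [Finset.mem_Icc] at hi hj
    rcases lt_trichotomy i j with h | h | h
    · exact absurd hij (hmono i j hi.1 h hj.2).ne
    · exact h
    · exact absurd hij (hmono j i hj.1 h hi.2).ne'
  obtain ⟨c, hc⟩ := growth_module K m M (m - s) hcodim (β 0) ε
  let N := 1 + ∑ i ∈ Finset.range (s + 1), d i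
  have hN : ∀ i ∈ Finset.range (s + 1), d i ≤ N := fun i hi =>
    (Finset.single_le_sum (f := d) (fun _ _ => Nat.zero_le _) hi).trans (Nat.le_add_left _ _)
  refine moments (m := m) (s := s) (r := m - s) (by omega) (fun i => (-1 : ℚ) ^ i * (β i : ℚ)) d
    (Finset.range (s + 1)) N hN c ?_
  intro n hn
  let ρ : ℕ → ℚ := fun k => match k with
    | 0 => (Module.finrank K ((filt K m (β 0) (d 0) n).map (ε.restrictScalars K)) : ℚ)
    | k + 1 => (Module.finrank K ((filt K m (β (k + 1)) (d (k + 1)) n).map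
        ((ψ k).restrictScalars K)) : ℚ)
  have htel := telescoping (fun i => (β i : ℚ) * ((n - d i + m).choose m : ℚ)) ρ s (by
    intro k hk
    have hdn : d k ≤ n := (hN k (Finset.mem_range.2 (by omega))).trans hn
    have hfr := finrank_filt K m (β k) (d k) n hdn
    have hfin := finite_filt K m (β k) (d k) n hdn
    have hfr' : (β k : ℚ) * ((n - d k + m).choose m : ℚ) =
        (Module.finrank K (filt K m (β k) (d k) n) : ℚ) := by rw [hfr]; push_cast; rfl
    change (β k : ℚ) * ((n - d k + m).choose m : ℚ) = _
    rw [hfr']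
    cases k with
    | zero =>
      have := rank_step ((ψ 0).restrictScalars K) (ε.restrictScalars K) hexact₀
        (filt K m (β 1) (d 1) n) (filt K m (β 0) (d 0) n) (trunc K m (β 1) (d 1) n)
        (trunc K m (β 0) (d 0) n) (trunc_mem K m _ _ n) (trunc_eq K m _ _ n)
        (trunc_mem K m _ _ n) (trunc_eq K m _ _ n)
        (trunc_comm K m _ _ _ _ n (ψ 0) (hψgr 0))
      rw [this]; push_cast; rfl
    | succ k =>
      have := rank_step ((ψ (k + 1)).restrictScalars K) ((ψ k).restrictScalars K) (hexact k)
        (filt K m (β (k + 2)) (d (k + 2)) n) (filt K m (β (k + 1)) (d (k + 1)) n)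
        (trunc K m (β (k + 2)) (d (k + 2)) n)
        (trunc K m (β (k + 1)) (d (k + 1)) n) (trunc_mem K m _ _ n) (trunc_eq K m _ _ n)
        (trunc_mem K m _ _ n) (trunc_eq K m _ _ n)
        (trunc_comm K m _ _ _ _ n (ψ (k + 1)) (hψgr (k + 1)))
      rw [this]; push_cast; rfl)
  have hlast : ρ (s + 1) = 0 := by
    have hb : β (s + 1) = 0 := hβ _ (by omega)
    have hem : IsEmpty (Fin (β (s + 1))) := by rw [hb]; infer_instance
    have h0 : (filt K m (β (s + 1)) (d (s + 1)) n).map ((ψ s).restrictScalars K) = ⊥ := by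
      rw [eq_bot_iff]
      rintro _ ⟨w, -, rfl⟩
      rw [Subsingleton.elim w 0, map_zero]
      exact Submodule.zero_mem _
    change (Module.finrank K ((filt K m (β (s + 1)) (d (s + 1)) n).map
        ((ψ s).restrictScalars K)) : ℚ) = 0
    rw [h0]; simp
  rw [hlast, mul_zero, add_zero] at htel
  simp only [← mul_assoc] at htel
  rw [htel]
  have hb := hc n ((Nat.le_add_right 1 _).trans hn) (filt K m (β 0) (d 0) n) (fun w hw t => by
    have := filt_mem_rtd hw t
    rwa [hd0, Nat.sub_zero] at this)
  change |(Module.finrank K ((filt K m (β 0) (d 0) n).map (ε.restrictScalars K)) : ℚ)| ≤ _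
  rw [abs_of_nonneg (Nat.cast_nonneg _)]
  exact_mod_cast hb

end Paper
end
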